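/- arXiv:2603.26119 — 2 statements merged into one kernel-verified Lean document; each statement's English description precedes it below -/
import Mathlib

section
/- Fix an integer d ≥ 1, a real γ > 0, a real C̄ > 1, and an integer M ≥ 0. Let φ be a Schwartz function on ℝ^d such that ∫_{ℝ^d} x^β φ(x) dx = 0 for every multi-index β with |β| ≤ M. For j ∈ ℤ set φ_j(x) = 2^{−jd} φ(2^{−j}x), and for ℓ ∈ ℕ set R_{ℓ,j} = C̄·2^ℓ·2^j. Then there exists a family of smooth functions φ_{ℓ,j} : ℝ^d → ℂ (ℓ ∈ ℕ, j ∈ ℤ) such that: (1) for every x ∈ ℝ^d, φ_j(x) = ∑_{ℓ=0}^∞ (C̄ 2^ℓ)^{−γ} φ_{ℓ,j}(x), the series converging absolutely; (2) supp φ_{ℓ,j} ⊆ B(0, 2R_{ℓ,j}); (3) for every multi-index μ there is a constant C_μ, independent of j and ℓ, with |∂^μ φ_{ℓ,j}(x)| ≤ C_μ · R_{ℓ,j}^{−|μ|} / |B(0, R_{ℓ,j})| for all x; and (4) ∫_{ℝ^d} x^β φ_{ℓ,j}(x) dx = 0 for every multi-index β with |β| ≤ M. -/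
open MeasureTheory Set Metric ENNReal

noncomputable section

abbrev Em (d : ℕ) := EuclideanSpace ℝ (Fin d)

/-- Iterated partial derivative of `f` along the list of coordinate directions. -/
def pderivL {V : Type*} [NormedAddCommGroup V] [NormedSpace ℝ V]
    (L : List V) (f : V → ℂ) : V → ℂ :=
  L.foldr (fun v g => fun x => fderiv ℝ g x v) f

open scoped ContDiff

/-- The monomial `x ^ β` on `ℝ^d`. -/
def euclideanMonomial {d : ℕ} (β : Fin d → ℕ) (x : Em d) : ℝ := ∏ i, x i ^ β i

section Monomial

variable {d : ℕ}

@[fun_prop]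
lemma continuous_euclideanMonomial (β : Fin d → ℕ) : Continuous (euclideanMonomial β) := by
  unfold euclideanMonomial
  fun_prop

lemma euclideanMonomial_smul (β : Fin d → ℕ) (c : ℝ) (x : Em d) :
    euclideanMonomial β (c • x) = c ^ (∑ i, β i) * euclideanMonomial β x := by
  simp [euclideanMonomial, mul_pow, Finset.prod_mul_distrib, Finset.prod_pow_eq_pow_sum]

lemma abs_euclideanMonomial_le (β : Fin d → ℕ) (x : Em d) :
    |euclideanMonomial β x| ≤ ‖x‖ ^ (∑ i, β i) := by
  rw [euclideanMonomial, Finset.abs_prod, ← Finset.prod_pow_eq_pow_sum]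
  gcongr with i
  rw [abs_pow]
  gcongr
  exact PiLp.norm_apply_le x i

lemma integral_euclideanMonomial_smul_comp_smul (β : Fin d → ℕ) (f : Em d → ℂ) {r : ℝ}
    (hr : 0 < r) :
    ∫ x, euclideanMonomial β x • f (r⁻¹ • x) =
      r ^ (d + ∑ i, β i) • ∫ x, euclideanMonomial β x • f x := by
  have h := Measure.integral_comp_inv_smul_of_nonneg volume
    (fun x : Em d => euclideanMonomial β (r • x) • f x) hr.le
  simp only [smul_inv_smul₀ hr.ne', finrank_euclideanSpace, Fintype.card_fin] at h
  rw [h]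
  simp only [euclideanMonomial_smul, mul_smul]
  rw [integral_smul, smul_smul, pow_add]

/-- A linear combination of distinct monomials that vanishes on the unit ball is trivial. -/
lemma eq_zero_of_sum_euclideanMonomial_eq_zero {ι : Type*} [Fintype ι] {b : ι → Fin d → ℕ}
    (hb : Function.Injective b) (c : ι → ℝ)
    (h : ∀ x ∈ ball (0 : Em d) 1, ∑ k, c k * euclideanMonomial (b k) x = 0) : c = 0 := by
  classical
  let q : MvPolynomial (Fin d) ℝ :=
    ∑ k, MvPolynomial.monomial (Finsupp.equivFunOnFinite.symm (b k)) (c k)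
  have hev (x : Fin d → ℝ) : MvPolynomial.eval x q =
      ∑ k, c k * euclideanMonomial (b k) (WithLp.toLp 2 x) := by
    simp [q, MvPolynomial.eval_monomial, euclideanMonomial, Finsupp.prod_fintype]
  have hopen : IsOpen ((WithLp.toLp 2 : (Fin d → ℝ) → Em d) ⁻¹' ball 0 1) :=
    isOpen_ball.preimage (PiLp.continuous_toLp 2 _)
  obtain ⟨ε, hε, hsub⟩ := Metric.isOpen_iff.1 hopen 0 (by simp)
  have hq : q = 0 := by
    refine MvPolynomial.funext_set (fun _ => ball (0 : ℝ) ε) (fun _ => ?_) fun x hx => ?_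
    · rw [Real.ball_eq_Ioo]
      exact Ioo_infinite (by linarith)
    · rw [hev, map_zero]
      refine h _ (hsub ?_)
      rw [ball_pi _ hε]
      exact hx
  funext k
  have hk := congrArg (MvPolynomial.coeff (Finsupp.equivFunOnFinite.symm (b k))) hq
  simpa [q, MvPolynomial.coeff_sum, MvPolynomial.coeff_monomial, hb.eq_iff] using hk

/-- Smooth functions supported in the unit ball that are dual to finitely many monomials. -/
lemma exists_dual_euclideanMonomial {ι : Type*} [Fintype ι] [DecidableEq ι] {b : ι → Fin d → ℕ}
    (hb : Function.Injective b) :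
    ∃ η : ι → Em d → ℝ, ∀ k, ContDiff ℝ ∞ (η k) ∧ HasCompactSupport (η k) ∧
      tsupport (η k) ⊆ ball 0 1 ∧
      ∀ l, ∫ x, euclideanMonomial (b l) x * η k x = if l = k then 1 else 0 := by
  have hint {g : Em d → ℝ} (hg : Continuous g) (hgc : HasCompactSupport g) (l : ι) :
      Integrable fun x => euclideanMonomial (b l) x * g x :=
    ((continuous_euclideanMonomial _).mul hg).integrable_of_hasCompactSupport hgc.mul_left
  let S : Submodule ℝ (ι → ℝ) :=
    { carrier := {m | ∃ g : Em d → ℝ, ContDiff ℝ ∞ g ∧ HasCompactSupport g ∧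
        tsupport g ⊆ ball 0 1 ∧ ∀ l, ∫ x, euclideanMonomial (b l) x * g x = m l}
      zero_mem' := ⟨0, contDiff_const, HasCompactSupport.zero, by simp, by simp⟩
      add_mem' := by
        rintro m m' ⟨g, hg, hgc, hgs, hgm⟩ ⟨g', hg', hgc', hgs', hgm'⟩
        refine ⟨g + g', hg.add hg', hgc.add hgc',
          (tsupport_add g g').trans (union_subset hgs hgs'), fun l => ?_⟩
        simp only [Pi.add_apply, mul_add]
        rw [integral_add (hint hg.continuous hgc l) (hint hg'.continuous hgc' l), hgm, hgm']
      smul_mem' := by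
        rintro a m ⟨g, hg, hgc, hgs, hgm⟩
        refine ⟨fun x => a * g x, contDiff_const.mul hg, hgc.mul_left,
          (tsupport_mul_subset_right).trans hgs, fun l => ?_⟩
        simp only [mul_left_comm _ a]
        rw [integral_const_mul, hgm, Pi.smul_apply, smul_eq_mul] }
  have hS : S = ⊤ := by
    by_contra hne
    obtain ⟨f, hf, hle⟩ := S.exists_le_ker_of_lt_top (lt_top_iff_ne_top.2 hne)
    refine hf ?_
    let c : ι → ℝ := fun k => f (Pi.single k 1)
    have hfc (m : ι → ℝ) : f m = ∑ k, c k * m k := by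
      rw [LinearMap.pi_apply_eq_sum_univ f m]
      refine Finset.sum_congr rfl fun k _ => ?_
      rw [smul_eq_mul, mul_comm]
      congr 2
      funext i
      simp [Pi.single_apply, eq_comm]
    have hcont : Continuous fun x : Em d => ∑ k, c k * euclideanMonomial (b k) x := by fun_prop
    have hae := isOpen_ball.ae_eq_zero_of_integral_contDiff_smul_eq_zero
      (U := ball (0 : Em d) 1) (μ := volume) (hcont.locallyIntegrable.locallyIntegrableOn _)
      fun g hg hgc hgs => by
        have h0 : f (fun l => ∫ x, euclideanMonomial (b l) x * g x) = 0 :=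
          hle ⟨g, hg, hgc, hgs, fun _ => rfl⟩
        rw [hfc] at h0
        simp only [← integral_const_mul] at h0
        rw [← integral_finsetSum _ fun k _ => (hint hg.continuous hgc k).const_mul _] at h0
        rw [← h0]
        refine integral_congr_ae (.of_forall fun x => ?_)
        simp only [smul_eq_mul, Finset.mul_sum]
        exact Finset.sum_congr rfl fun k _ => by ring
    have hc : c = 0 := by
      refine eq_zero_of_sum_euclideanMonomial_eq_zero hb c ?_
      exact Measure.eqOn_open_of_ae_eq (μ := volume) (g := fun _ => (0 : ℝ))
        ((ae_restrict_iff' measurableSet_ball).2 hae) isOpen_ball hcont.continuousOn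
        continuousOn_const
    refine LinearMap.pi_ext' fun k => LinearMap.ext_ring ?_
    simpa [hc] using hfc (Pi.single k 1)
  have hmem (k : ι) : (fun l => if l = k then (1 : ℝ) else 0) ∈ S := hS ▸ Submodule.mem_top
  choose η hη using hmem
  exact ⟨η, hη⟩

end Monomial

lemma pderivL_eq_iteratedFDeriv {V : Type*} [NormedAddCommGroup V] [NormedSpace ℝ V]
    {f : V → ℂ} (hf : ContDiff ℝ ∞ f) (L : List V) :
    pderivL L f = fun x => iteratedFDeriv ℝ L.length f x L.get := by
  induction L with
  | nil => funext x; simp [pderivL]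
  | cons v L ih =>
    funext x
    have hd : DifferentiableAt ℝ (iteratedFDeriv ℝ L.length f) x :=
      (hf.differentiable_iteratedFDeriv (by exact_mod_cast ENat.natCast_lt_top L.length)) x
    change fderiv ℝ (pderivL L f) x v = _
    rw [ih, fderiv_continuousMultilinear_apply_const_apply hd]
    exact (iteratedFDeriv_succ_apply_left (𝕜 := ℝ) (f := f) (x := x) (v :: L).get).symm

lemma norm_pderivL_single_le {d : ℕ} {f : Em d → ℂ} (hf : ContDiff ℝ ∞ f) (μ : List (Fin d))
    (x : Em d) :
    ‖pderivL (μ.map fun i => EuclideanSpace.single i (1 : ℝ)) f x‖ ≤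
      ‖iteratedFDeriv ℝ μ.length f x‖ := by
  rw [pderivL_eq_iteratedFDeriv hf]
  refine (ContinuousMultilinearMap.le_opNorm _ _).trans ?_
  simp only [List.get_eq_getElem, List.getElem_map, PiLp.norm_single, norm_one,
    Finset.prod_const_one, mul_one]
  rw [List.length_map]

lemma exists_norm_iteratedFDeriv_le_of_hasCompactSupport {E F : Type*} [NormedAddCommGroup E]
    [NormedSpace ℝ E] [NormedAddCommGroup F] [NormedSpace ℝ F] {f : E → F}
    (hfc : HasCompactSupport f) (hf : ContDiff ℝ ∞ f) (n : ℕ) :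
    ∃ C, 0 ≤ C ∧ ∀ y, ‖iteratedFDeriv ℝ n f y‖ ≤ C := by
  obtain ⟨C, hC⟩ := (HasCompactSupport.iteratedFDeriv (𝕜 := ℝ) hfc n).exists_bound_of_continuous
    (hf.continuous_iteratedFDeriv (by exact_mod_cast le_top))
  exact ⟨C, (norm_nonneg _).trans (hC 0), hC⟩

/-- A family of smooth functions, indexed by `R ≥ 1`, all of whose derivatives are uniformly
`O(R ^ (-N))` for every `N`. -/
structure RapidlyDecreasing {E : Type*} [NormedAddCommGroup E] [NormedSpace ℝ E]
    (F : ℝ → E → ℂ) : Prop where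
  contDiff : ∀ R, 1 ≤ R → ContDiff ℝ ∞ (F R)
  bound : ∀ n N : ℕ, ∃ C, ∀ R, 1 ≤ R → ∀ y, R ^ N * ‖iteratedFDeriv ℝ n (F R) y‖ ≤ C

namespace RapidlyDecreasing

variable {E : Type*} [NormedAddCommGroup E] [NormedSpace ℝ E]

lemma congr {F G : ℝ → E → ℂ} (hF : RapidlyDecreasing F) (h : ∀ R, 1 ≤ R → G R = F R) :
    RapidlyDecreasing G where
  contDiff R hR := h R hR ▸ hF.contDiff R hR
  bound n N := by
    obtain ⟨C, hC⟩ := hF.bound n N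
    exact ⟨C, fun R hR => h R hR ▸ hC R hR⟩

lemma sub {F G : ℝ → E → ℂ} (hF : RapidlyDecreasing F) (hG : RapidlyDecreasing G) :
    RapidlyDecreasing fun R y => F R y - G R y where
  contDiff R hR := (hF.contDiff R hR).sub (hG.contDiff R hR)
  bound n N := by
    obtain ⟨C, hC⟩ := hF.bound n N
    obtain ⟨C', hC'⟩ := hG.bound n N
    refine ⟨C + C', fun R hR y => ?_⟩
    have h : iteratedFDeriv ℝ n (fun y => F R y - G R y) y =
        iteratedFDeriv ℝ n (F R) y - iteratedFDeriv ℝ n (G R) y :=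
      iteratedFDeriv_sub_apply ((hF.contDiff R hR).contDiffAt.of_le (by exact_mod_cast le_top))
        ((hG.contDiff R hR).contDiffAt.of_le (by exact_mod_cast le_top))
    rw [h]
    calc _ ≤ R ^ N * (‖iteratedFDeriv ℝ n (F R) y‖ + ‖iteratedFDeriv ℝ n (G R) y‖) := by
          gcongr
          exact norm_sub_le _ _
      _ ≤ C + C' := by linarith [hC R hR y, hC' R hR y]

lemma sum {ι : Type*} {s : Finset ι} {F : ι → ℝ → E → ℂ}
    (hF : ∀ k ∈ s, RapidlyDecreasing (F k)) :
    RapidlyDecreasing fun R y => ∑ k ∈ s, F k R y where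
  contDiff R hR := ContDiff.sum fun k hk => (hF k hk).contDiff R hR
  bound n N := by
    choose! C hC using fun k hk => (hF k hk).bound n N
    refine ⟨∑ k ∈ s, C k, fun R hR y => ?_⟩
    rw [iteratedFDeriv_fun_sum_apply fun k hk =>
      ((hF k hk).contDiff R hR).contDiffAt.of_le (by exact_mod_cast le_top)]
    calc _ ≤ R ^ N * ∑ k ∈ s, ‖iteratedFDeriv ℝ n (F k R) y‖ := by
          gcongr
          exact norm_sum_le _ _
      _ ≤ _ := by
          rw [Finset.mul_sum]
          exact Finset.sum_le_sum fun k hk => hC k hk R hR y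

lemma smul_const {η : E → ℝ} (hη : ContDiff ℝ ∞ η) (hηc : HasCompactSupport η) {c : ℝ → ℂ}
    (hc : ∀ N : ℕ, ∃ C, ∀ R, 1 ≤ R → R ^ N * ‖c R‖ ≤ C) :
    RapidlyDecreasing fun R y => η y • c R where
  contDiff R _ := hη.smul contDiff_const
  bound n N := by
    obtain ⟨B, hB0, hB⟩ := exists_norm_iteratedFDeriv_le_of_hasCompactSupport hηc hη n
    obtain ⟨C, hC⟩ := hc N
    refine ⟨B * C, fun R hR y => ?_⟩
    have h : ‖iteratedFDeriv ℝ n (fun y => η y • c R) y‖ ≤ ‖c R‖ * B := by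
      have h1 := ((ContinuousLinearMap.id ℝ ℝ).smulRight (c R)).norm_iteratedFDeriv_comp_left
        (f := η) (x := y) (n := n) hη.contDiffAt (by exact_mod_cast le_top)
      refine h1.trans ?_
      gcongr
      · refine (ContinuousLinearMap.norm_smulRight_apply _ _).le.trans ?_
        exact mul_le_of_le_one_left (norm_nonneg _) ContinuousLinearMap.norm_id_le
      · exact hB y
    calc _ ≤ R ^ N * (‖c R‖ * B) := by gcongr
      _ = B * (R ^ N * ‖c R‖) := by ring
      _ ≤ B * C := by gcongr; exact hC R hR

/-- Dilates of a Schwartz function decrease rapidly away from the origin. -/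
lemma cutoff_smul_comp_smul {ζ : E → ℝ} (hζ : ContDiff ℝ ∞ ζ) (hζc : HasCompactSupport ζ)
    (hζ0 : ∀ y, ‖y‖ < 1 / 2 → ζ y = 0) (φ : SchwartzMap E ℂ) :
    RapidlyDecreasing fun R y => ζ y • φ (R • y) where
  contDiff R _ := hζ.smul ((φ.smooth ⊤).comp (contDiff_const_smul R))
  bound n N := by
    choose B hB0 hB using exists_norm_iteratedFDeriv_le_of_hasCompactSupport hζc hζ
    choose C hC0 hC using fun k m => φ.decay k m
    have hts : tsupport ζ ⊆ (ball (0 : E) (1 / 2))ᶜ := by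
      refine closure_minimal (fun y hy hy' => hy (hζ0 y ?_)) isOpen_ball.isClosed_compl
      simpa using hy'
    refine ⟨∑ i ∈ Finset.range (n + 1), (n.choose i : ℝ) * B i *
      (2 ^ (N + (n - i)) * C (N + (n - i)) (n - i)), fun R hR y => ?_⟩
    have hR0 : (0 : ℝ) < R := by linarith
    have hφR : ContDiff ℝ ∞ fun y => φ (R • y) := (φ.smooth ⊤).comp (contDiff_const_smul R)
    have hle := norm_iteratedFDeriv_smul_le (n := n) hζ hφR y (by exact_mod_cast le_top)
    refine (mul_le_mul_of_nonneg_left hle (by positivity)).trans ?_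
    rw [Finset.mul_sum]
    refine Finset.sum_le_sum fun i _ => ?_
    by_cases hy : y ∈ ball (0 : E) (1 / 2)
    · have h0 : iteratedFDeriv ℝ i ζ y = 0 := by
        by_contra h
        exact hts (support_iteratedFDeriv_subset i h) hy
      rw [h0]
      simp only [norm_zero, mul_zero, zero_mul]
      have := hB0 i
      have := (hC0 (N + (n - i)) (n - i)).le
      positivity
    · have hy' : 1 ≤ 2 * ‖y‖ := by
        simp only [mem_ball_zero_iff, not_lt] at hy
        linarith
      generalize n - i = m
      rw [iteratedFDeriv_comp_const_smul (i := m) R ((φ.smooth ⊤).of_le (by exact_mod_cast le_top))]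
      rw [norm_smul, norm_pow, Real.norm_of_nonneg hR0.le]
      have h1 : R ^ (N + m) * ‖iteratedFDeriv ℝ m φ (R • y)‖ ≤ 2 ^ (N + m) * C (N + m) m := by
        calc _ ≤ (2 * ‖R • y‖) ^ (N + m) * ‖iteratedFDeriv ℝ m φ (R • y)‖ := by
              gcongr
              rw [norm_smul, Real.norm_of_nonneg hR0.le]
              nlinarith
          _ = 2 ^ (N + m) * (‖R • y‖ ^ (N + m) * ‖iteratedFDeriv ℝ m φ (R • y)‖) := by ring
          _ ≤ _ := by gcongr; exact hC _ _ _
      calc _ = (n.choose i : ℝ) * ‖iteratedFDeriv ℝ i ζ y‖ *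
            (R ^ (N + m) * ‖iteratedFDeriv ℝ m φ (R • y)‖) := by ring
        _ ≤ _ := by
          have := hB0 i
          gcongr
          exact hB i y

end RapidlyDecreasing

section Truncation

variable {d : ℕ}

/-- The moment of order `β` of the Schwartz function `φ` truncated at scale `R`. -/
def truncatedMoment (χ : Em d → ℝ) (φ : SchwartzMap (Em d) ℂ) (β : Fin d → ℕ) (R : ℝ) : ℂ :=
  ∫ x, euclideanMonomial β x • χ (R⁻¹ • x) • φ x

lemma exists_pow_mul_norm_truncatedMoment_le {χ : Em d → ℝ} (hχ : Continuous χ)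
    (hχ0 : ∀ x, 0 ≤ χ x) (hχ1 : ∀ x, χ x ≤ 1) (hχ_one : ∀ x, ‖x‖ ≤ 1 → χ x = 1)
    (φ : SchwartzMap (Em d) ℂ) {β : Fin d → ℕ} (hφ : ∫ x, euclideanMonomial β x • φ x = 0)
    (N : ℕ) : ∃ C, 0 ≤ C ∧ ∀ R, 0 < R → R ^ N * ‖truncatedMoment χ φ β R‖ ≤ C := by
  have hdom (K : ℕ) : Integrable fun x => ‖x‖ ^ K * ‖φ x‖ := φ.integrable_pow_mul volume K
  have hmono : Integrable fun x => euclideanMonomial β x • φ x := by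
    refine (hdom (∑ i, β i)).mono'
      ((continuous_euclideanMonomial β).smul φ.continuous).aestronglyMeasurable
      (.of_forall fun x => ?_)
    rw [norm_smul]
    gcongr
    exact abs_euclideanMonomial_le β x
  refine ⟨∫ x, ‖x‖ ^ (N + ∑ i, β i) * ‖φ x‖, integral_nonneg fun x => by positivity,
    fun R hR => ?_⟩
  have hχR : Continuous fun x : Em d => χ (R⁻¹ • x) := by fun_prop
  have htr : Integrable fun x => euclideanMonomial β x • χ (R⁻¹ • x) • φ x := by
    refine hmono.norm.mono' ((continuous_euclideanMonomial β).smul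
      (hχR.smul φ.continuous)).aestronglyMeasurable (.of_forall fun x => ?_)
    rw [norm_smul, norm_smul, norm_smul, Real.norm_of_nonneg (hχ0 _)]
    gcongr
    exact mul_le_of_le_one_left (norm_nonneg _) (hχ1 _)
  have hA : truncatedMoment χ φ β R =
      ∫ x, euclideanMonomial β x • (χ (R⁻¹ • x) - 1) • φ x := by
    have h := integral_sub htr hmono
    rw [hφ, sub_zero] at h
    rw [truncatedMoment, ← h]
    simp only [sub_smul, smul_sub, one_smul]
  rw [hA, ← Real.norm_of_nonneg (pow_nonneg hR.le N), ← norm_smul, ← integral_smul]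
  refine norm_integral_le_of_norm_le (hdom _) (.of_forall fun x => ?_)
  rw [norm_smul, norm_smul, norm_smul, Real.norm_of_nonneg (pow_nonneg hR.le N)]
  rcases le_or_gt ‖x‖ R with hx | hx
  · rw [hχ_one, sub_self, norm_zero]
    · simp only [zero_mul, mul_zero]
      positivity
    · rw [norm_smul, norm_inv, Real.norm_of_nonneg hR.le]
      exact inv_mul_le_one_of_le₀ hx hR.le
  · have h1 : ‖χ (R⁻¹ • x) - 1‖ ≤ 1 := by
      rw [Real.norm_eq_abs, abs_le]
      constructor <;> linarith [hχ0 (R⁻¹ • x), hχ1 (R⁻¹ • x)]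
    calc _ ≤ ‖x‖ ^ N * (‖x‖ ^ (∑ i, β i) * (1 * ‖φ x‖)) := by
          gcongr
          exact abs_euclideanMonomial_le β x
      _ = _ := by ring

/-- The truncation of `φ` at scale `R`, corrected by multiples of the `η k` so as to have
vanishing moments of orders `b k`. -/
def correctedTruncation {ι : Type*} [Fintype ι] (b : ι → Fin d → ℕ) (η : ι → Em d → ℝ)
    (χ : Em d → ℝ) (φ : SchwartzMap (Em d) ℂ) (R : ℝ) (x : Em d) : ℂ :=
  χ (R⁻¹ • x) • φ x -
    ∑ k, η k (R⁻¹ • x) • (((R ^ (d + ∑ i, b k i))⁻¹ : ℝ) • truncatedMoment χ φ (b k) R)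

section CorrectedTruncation

variable {ι : Type*} [Fintype ι] {b : ι → Fin d → ℕ} {η : ι → Em d → ℝ} {χ : Em d → ℝ}

lemma contDiff_correctedTruncation (hη : ∀ k, ContDiff ℝ ∞ (η k)) (hχ : ContDiff ℝ ∞ χ)
    (φ : SchwartzMap (Em d) ℂ) (R : ℝ) : ContDiff ℝ ∞ (correctedTruncation b η χ φ R) := by
  have hR : ContDiff ℝ ∞ fun x : Em d => R⁻¹ • x := contDiff_const_smul _
  exact ((hχ.comp hR).smul (φ.smooth ⊤)).sub
    (ContDiff.sum fun k _ => ((hη k).comp hR).smul contDiff_const)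

lemma correctedTruncation_eq_zero (hηs : ∀ k x, 2 ≤ ‖x‖ → η k x = 0)
    (hχs : ∀ x, 2 ≤ ‖x‖ → χ x = 0) (φ : SchwartzMap (Em d) ℂ) {R : ℝ} {x : Em d}
    (hx : 2 ≤ ‖R⁻¹ • x‖) : correctedTruncation b η χ φ R x = 0 := by
  simp [correctedTruncation, hχs _ hx, hηs _ _ hx]

lemma integral_euclideanMonomial_smul_correctedTruncation [DecidableEq ι]
    (hη : ∀ k, Continuous (η k)) (hηc : ∀ k, HasCompactSupport (η k))
    (hdual : ∀ k l, ∫ x, euclideanMonomial (b l) x * η k x = if l = k then 1 else 0)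
    (hχ : Continuous χ) (hχc : HasCompactSupport χ) (φ : SchwartzMap (Em d) ℂ) {R : ℝ}
    (hR : 0 < R) (l : ι) :
    ∫ x, euclideanMonomial (b l) x • correctedTruncation b η χ φ R x = 0 := by
  have hR' : R⁻¹ ≠ 0 := inv_ne_zero hR.ne'
  have hmono := continuous_euclideanMonomial (b l)
  have hint : Integrable fun x => euclideanMonomial (b l) x • χ (R⁻¹ • x) • φ x :=
    (hmono.smul ((hχ.comp (continuous_const_smul _)).smul
      φ.continuous)).integrable_of_hasCompactSupport
      ((hχc.comp_smul hR').smul_right.smul_left)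
  have hint' (k : ι) (c : ℂ) :
      Integrable fun x => euclideanMonomial (b l) x • η k (R⁻¹ • x) • c :=
    (hmono.smul (((hη k).comp (continuous_const_smul _)).smul
      continuous_const)).integrable_of_hasCompactSupport
      (((hηc k).comp_smul hR').smul_right.smul_left)
  have hval (k : ι) (c : ℂ) : ∫ x, euclideanMonomial (b l) x • η k (R⁻¹ • x) • c =
      if l = k then R ^ (d + ∑ i, b l i) • c else 0 := by
    rw [integral_euclideanMonomial_smul_comp_smul (b l) (fun y => η k y • c) hR]
    simp only [smul_smul]
    rw [integral_smul_const, hdual]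
    split_ifs <;> simp
  simp only [correctedTruncation, smul_sub, Finset.smul_sum]
  rw [integral_sub hint (integrable_finsetSum _ fun k _ => hint' k _),
    integral_finsetSum _ fun k _ => hint' k _]
  simp only [hval, Finset.sum_ite_eq, Finset.mem_univ, if_true]
  rw [smul_inv_smul₀ (pow_pos hR _).ne', truncatedMoment, sub_self]

lemma exists_pow_mul_norm_inv_pow_smul_le {A : ℝ → ℂ}
    (hA : ∀ N : ℕ, ∃ C, 0 ≤ C ∧ ∀ R, 0 < R → R ^ N * ‖A R‖ ≤ C) {s : ℝ} (hs : 0 < s) (m N : ℕ) :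
    ∃ C, ∀ R, 1 ≤ R → R ^ N * ‖(((s * R) ^ m)⁻¹ : ℝ) • A (s * R)‖ ≤ C := by
  obtain ⟨C, hC0, hC⟩ := hA N
  refine ⟨(s ^ N)⁻¹ * (s ^ m)⁻¹ * C, fun R hR => ?_⟩
  have hR0 : 0 < R := by linarith
  rw [norm_smul, Real.norm_of_nonneg (by positivity), mul_pow, mul_inv]
  have h1 : (R ^ m)⁻¹ ≤ 1 := inv_le_one_of_one_le₀ (one_le_pow₀ hR)
  calc _ = (s ^ N)⁻¹ * ((s ^ m)⁻¹ * (R ^ m)⁻¹) * ((s * R) ^ N * ‖A (s * R)‖) := by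
        rw [mul_pow s R N]
        field_simp
    _ ≤ (s ^ N)⁻¹ * ((s ^ m)⁻¹ * 1) * C := by
        gcongr
        exact hC _ (by positivity)
    _ = _ := by ring

lemma rapidlyDecreasing_correctedTruncation_sub (hη : ∀ k, ContDiff ℝ ∞ (η k))
    (hηc : ∀ k, HasCompactSupport (η k)) (hχ : ContDiff ℝ ∞ χ) (hχc : HasCompactSupport χ)
    (hχ0 : ∀ x, 0 ≤ χ x) (hχ1 : ∀ x, χ x ≤ 1) (hχ_one : ∀ x, ‖x‖ ≤ 1 → χ x = 1)
    (φ : SchwartzMap (Em d) ℂ) (hφ : ∀ k, ∫ x, euclideanMonomial (b k) x • φ x = 0) :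
    RapidlyDecreasing fun R y => correctedTruncation b η χ φ R (R • y) -
      correctedTruncation b η χ φ (2⁻¹ * R) (R • y) := by
  have hA (k : ι) := exists_pow_mul_norm_truncatedMoment_le hχ.continuous hχ0 hχ1 hχ_one φ (hφ k)
  have htwo : ContDiff ℝ ∞ fun y : Em d => (2 : ℝ) • y := contDiff_const_smul _
  have hmain : RapidlyDecreasing fun R y => (χ y - χ ((2 : ℝ) • y)) • φ (R • y) := by
    refine RapidlyDecreasing.cutoff_smul_comp_smul (hχ.sub (hχ.comp htwo))
      (hχc.sub (hχc.comp_smul two_ne_zero)) (fun y hy => ?_) φ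
    rw [Function.comp_apply, hχ_one, hχ_one, sub_self]
    · rw [norm_smul, Real.norm_ofNat]
      linarith
    · linarith
  have h1 : RapidlyDecreasing fun R y => ∑ k, η k y •
      (((1 * R) ^ (d + ∑ i, b k i))⁻¹ : ℝ) • truncatedMoment χ φ (b k) (1 * R) :=
    RapidlyDecreasing.sum fun k _ => RapidlyDecreasing.smul_const (hη k) (hηc k)
      (exists_pow_mul_norm_inv_pow_smul_le (hA k) one_pos _)
  have h2 : RapidlyDecreasing fun R y => ∑ k, η k ((2 : ℝ) • y) •
      (((2⁻¹ * R) ^ (d + ∑ i, b k i))⁻¹ : ℝ) • truncatedMoment χ φ (b k) (2⁻¹ * R) :=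
    RapidlyDecreasing.sum fun k _ => RapidlyDecreasing.smul_const ((hη k).comp htwo)
      ((hηc k).comp_smul two_ne_zero)
      (exists_pow_mul_norm_inv_pow_smul_le (hA k) (by positivity) _)
  refine (hmain.sub (h1.sub h2)).congr fun R hR => ?_
  have hR0 : R ≠ 0 := by linarith
  funext y
  have e : (2⁻¹ * R)⁻¹ • R • y = (2 : ℝ) • y := by
    rw [smul_smul]
    congr 1
    field_simp
  simp only [correctedTruncation, inv_smul_smul₀ hR0, e, one_mul, sub_smul]
  abel

lemma tendsto_correctedTruncation (hη : ∀ k, ContDiff ℝ ∞ (η k))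
    (hηc : ∀ k, HasCompactSupport (η k)) (hχ : ContDiff ℝ ∞ χ)
    (hχ0 : ∀ x, 0 ≤ χ x) (hχ1 : ∀ x, χ x ≤ 1) (hχ_one : ∀ x, ‖x‖ ≤ 1 → χ x = 1)
    (φ : SchwartzMap (Em d) ℂ) (hφ : ∀ k, ∫ x, euclideanMonomial (b k) x • φ x = 0) (x : Em d) :
    Filter.Tendsto (fun R => correctedTruncation b η χ φ R x) Filter.atTop (nhds (φ x)) := by
  have hmain : Filter.Tendsto (fun R : ℝ => χ (R⁻¹ • x) • φ x) Filter.atTop (nhds (φ x)) := by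
    refine tendsto_const_nhds.congr' ?_
    filter_upwards [Filter.eventually_ge_atTop ‖x‖, Filter.eventually_gt_atTop 0] with R hR hR0
    rw [hχ_one, one_smul]
    rw [norm_smul, norm_inv, Real.norm_of_nonneg hR0.le]
    exact inv_mul_le_one_of_le₀ hR hR0.le
  have hcorr : Filter.Tendsto (fun R : ℝ => ∑ k, η k (R⁻¹ • x) •
      (((R ^ (d + ∑ i, b k i))⁻¹ : ℝ) • truncatedMoment χ φ (b k) R)) Filter.atTop
      (nhds (∑ k : ι, 0)) := by
    refine tendsto_finsetSum _ fun k _ => ?_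
    obtain ⟨B, hB⟩ := (hηc k).exists_bound_of_continuous (hη k).continuous
    obtain ⟨C, hC⟩ := exists_pow_mul_norm_inv_pow_smul_le
      (exists_pow_mul_norm_truncatedMoment_le hχ.continuous hχ0 hχ1 hχ_one φ (hφ k))
      one_pos (d + ∑ i, b k i) 1
    simp only [one_mul, pow_one] at hC
    have hB0 : 0 ≤ B := (norm_nonneg _).trans (hB 0)
    refine squeeze_zero_norm' (a := fun R : ℝ => B * C * R⁻¹) ?_ ?_
    · filter_upwards [Filter.eventually_ge_atTop 1] with R hR
      have hR0 : 0 < R := by linarith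
      rw [norm_smul, mul_assoc]
      gcongr
      · exact hB _
      · rw [le_mul_inv_iff₀ hR0, mul_comm]
        exact hC R hR
    · simpa using tendsto_inv_atTop_zero.const_mul (B * C)
  simpa [correctedTruncation] using hmain.sub hcorr

end CorrectedTruncation

end Truncation

lemma ContDiff.smul_comp_smul {E : Type*} [NormedAddCommGroup E] [NormedSpace ℝ E]
    {n : ℕ∞ω} {f : E → ℂ} (hf : ContDiff ℝ n f) (a c : ℝ) :
    ContDiff ℝ n fun x => a • f (c • x) :=
  (hf.comp (contDiff_const_smul c)).const_smul a

lemma norm_iteratedFDeriv_smul_comp_smul {E : Type*} [NormedAddCommGroup E] [NormedSpace ℝ E]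
    {f : E → ℂ} (hf : ContDiff ℝ ∞ f) {a c : ℝ} (ha : 0 ≤ a) (hc : 0 ≤ c) (n : ℕ) (x : E) :
    ‖iteratedFDeriv ℝ n (fun x => a • f (c • x)) x‖ =
      a * c ^ n * ‖iteratedFDeriv ℝ n f (c • x)‖ := by
  have hn : ContDiff ℝ n f := hf.of_le (by exact_mod_cast le_top)
  have hcomp : ContDiff ℝ n fun x => f (c • x) := hn.comp (contDiff_const_smul c)
  rw [iteratedFDeriv_const_smul_apply' hcomp.contDiffAt,
    iteratedFDeriv_comp_const_smul c hn, norm_smul, norm_smul, norm_pow, Real.norm_of_nonneg ha,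
    Real.norm_of_nonneg hc, mul_assoc]

/-- The decomposition with all pieces rescaled to unit size. -/
lemma exists_unit_scale_decomposition {d : ℕ} {s : ℝ} (hs : 0 < s) {Cb : ℝ} (hCb : 1 < Cb)
    (M : ℕ) (φ : SchwartzMap (Em d) ℂ)
    (hmom : ∀ β : Fin d → ℕ, (∑ i, β i) ≤ M → ∫ x, euclideanMonomial β x • φ x = 0) :
    ∃ g : ℕ → Em d → ℂ,
      (∀ ℓ, ContDiff ℝ ∞ (g ℓ)) ∧
      (∀ ℓ x, 2 ≤ ‖x‖ → g ℓ x = 0) ∧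
      (∀ n, ∃ C, ∀ ℓ x, ‖iteratedFDeriv ℝ n (g ℓ) x‖ ≤ C) ∧
      (∀ ℓ β, (∑ i, β i) ≤ M → ∫ x, euclideanMonomial β x • g ℓ x = 0) ∧
      ∀ x, (Summable fun ℓ : ℕ => ‖((Cb * 2 ^ ℓ) ^ (-s) : ℝ) • g ℓ ((Cb * 2 ^ ℓ)⁻¹ • x)‖) ∧
        ∑' ℓ : ℕ, ((Cb * 2 ^ ℓ) ^ (-s) : ℝ) • g ℓ ((Cb * 2 ^ ℓ)⁻¹ • x) = φ x := by
  classical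
  have hfin : Finite {β : Fin d → ℕ // ∑ i, β i ≤ M} :=
    Finite.of_injective
      (fun β i => (⟨β.1 i, Nat.lt_succ_of_le ((Finset.single_le_sum (fun _ _ => Nat.zero_le _)
        (Finset.mem_univ i)).trans β.2)⟩ : Fin (M + 1)))
      fun β β' h => Subtype.ext (funext fun i => congrArg Fin.val (congrFun h i))
  have := Fintype.ofFinite {β : Fin d → ℕ // ∑ i, β i ≤ M}
  obtain ⟨η, hη'⟩ := exists_dual_euclideanMonomial
    (b := fun β : {β : Fin d → ℕ // ∑ i, β i ≤ M} => β.1) Subtype.val_injective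
  choose hη hηc hηs hdual using hη'
  have hηs' : ∀ k x, 2 ≤ ‖x‖ → η k x = 0 := fun k x hx => by
    refine image_eq_zero_of_notMem_tsupport fun h => ?_
    have := mem_ball_zero_iff.1 (hηs k h)
    linarith
  let χ : ContDiffBump (0 : Em d) := ⟨1, 2, one_pos, one_lt_two⟩
  have hχ : ContDiff ℝ ∞ χ := χ.contDiff
  have hχs : ∀ x, 2 ≤ ‖x‖ → χ x = 0 := fun x hx => χ.zero_of_le_dist (by simpa using hx)
  have hχ_one : ∀ x, ‖x‖ ≤ 1 → χ x = 1 := fun x hx =>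
    χ.one_of_mem_closedBall (by simpa using hx)
  let T : ℝ → Em d → ℂ :=
    correctedTruncation (fun β : {β : Fin d → ℕ // ∑ i, β i ≤ M} => β.1) η χ φ
  have hT (R : ℝ) : ContDiff ℝ ∞ (T R) := contDiff_correctedTruncation hη hχ φ R
  have hTs {R : ℝ} {x : Em d} (hx : 2 ≤ ‖R⁻¹ • x‖) : T R x = 0 :=
    correctedTruncation_eq_zero hηs' hχs φ hx
  have hTc {R : ℝ} (hR : 0 < R) : HasCompactSupport (T R) := by
    refine HasCompactSupport.of_support_subset_isCompact (isCompact_closedBall 0 (R * 2))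
      fun x hx => ?_
    by_contra hx'
    refine hx (hTs ?_)
    rw [mem_closedBall_zero_iff, not_le] at hx'
    rw [norm_smul, norm_inv, Real.norm_of_nonneg hR.le, le_inv_mul_iff₀ hR]
    exact hx'.le
  have hTm {R : ℝ} (hR : 0 < R) {β : Fin d → ℕ} (hβ : ∑ i, β i ≤ M) :
      ∫ x, euclideanMonomial β x • T R x = 0 :=
    integral_euclideanMonomial_smul_correctedTruncation (fun k => (hη k).continuous) hηc hdual
      hχ.continuous χ.hasCompactSupport φ hR ⟨β, hβ⟩
  have hTi {R : ℝ} (hR : 0 < R) (β : Fin d → ℕ) :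
      Integrable fun x => euclideanMonomial β x • T R x :=
    ((continuous_euclideanMonomial β).smul (hT R).continuous).integrable_of_hasCompactSupport
      (hTc hR).smul_left
  have hTlim := tendsto_correctedTruncation hη hηc hχ χ.nonneg' (fun _ => χ.le_one) hχ_one φ
    fun k => hmom k.1 k.2
  have hTr := rapidlyDecreasing_correctedTruncation_sub hη hηc hχ χ.hasCompactSupport χ.nonneg'
    (fun _ => χ.le_one) hχ_one φ fun k => hmom k.1 k.2
  let R : ℕ → ℝ := fun ℓ => Cb * 2 ^ ℓ
  have hR1 (ℓ : ℕ) : 1 ≤ R ℓ := by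
    have : (1 : ℝ) ≤ 2 ^ ℓ := one_le_pow₀ one_le_two
    exact one_le_mul_of_one_le_of_one_le hCb.le this
  have hR0 (ℓ : ℕ) : 0 < R ℓ := one_pos.trans_le (hR1 ℓ)
  have hRsucc (ℓ : ℕ) : 2⁻¹ * R (ℓ + 1) = R ℓ := by
    simp only [R, pow_succ]
    ring
  let D : ℕ → Em d → ℂ := fun ℓ x => T (R ℓ) x - if ℓ = 0 then 0 else T (2⁻¹ * R ℓ) x
  have hD (ℓ : ℕ) : ContDiff ℝ ∞ (D ℓ) := by
    refine (hT _).sub ?_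
    split_ifs
    exacts [contDiff_const, hT _]
  have hDs {ℓ : ℕ} {y : Em d} (hy : 2 ≤ ‖y‖) : D ℓ (R ℓ • y) = 0 := by
    have h1 : T (R ℓ) (R ℓ • y) = 0 := hTs (by rwa [inv_smul_smul₀ (hR0 ℓ).ne'])
    have h2 : T (2⁻¹ * R ℓ) (R ℓ • y) = 0 := hTs (by
      rw [mul_inv, inv_inv, mul_smul, inv_smul_smul₀ (hR0 ℓ).ne', norm_smul, Real.norm_ofNat]
      linarith)
    simp [D, h1, h2]
  have hDsum (L : ℕ) (x : Em d) : ∑ ℓ ∈ Finset.range (L + 1), D ℓ x = T (R L) x := by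
    induction L with
    | zero => simp [D]
    | succ L ih =>
      rw [Finset.sum_range_succ, ih]
      simp [D, hRsucc]
  have hDm (ℓ : ℕ) {β : Fin d → ℕ} (hβ : ∑ i, β i ≤ M) :
      ∫ x, euclideanMonomial β x • D ℓ x = 0 := by
    have h2 : 0 < 2⁻¹ * R ℓ := mul_pos (by norm_num) (hR0 ℓ)
    by_cases h : ℓ = 0
    · simpa [D, h] using hTm (hR0 0) hβ
    · simp only [D, h, if_false, smul_sub]
      rw [integral_sub (hTi (hR0 ℓ) β) (hTi h2 β), hTm (hR0 ℓ) hβ, hTm h2 hβ, sub_zero]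
  let g : ℕ → Em d → ℂ := fun ℓ y => (R ℓ ^ s : ℝ) • D ℓ (R ℓ • y)
  have hg (ℓ : ℕ) : ContDiff ℝ ∞ (g ℓ) :=
    (hD ℓ).smul_comp_smul _ _
  have hgs (ℓ : ℕ) (x : Em d) (hx : 2 ≤ ‖x‖) : g ℓ x = 0 := by
    simp only [g, hDs hx, smul_zero]
  have hgb (n : ℕ) : ∃ C, ∀ ℓ x, ‖iteratedFDeriv ℝ n (g ℓ) x‖ ≤ C := by
    have hgc : HasCompactSupport (g 0) :=
      HasCompactSupport.intro (isCompact_closedBall 0 2) fun x hx => hgs 0 x (by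
        rw [mem_closedBall_zero_iff, not_le] at hx
        exact hx.le)
    obtain ⟨C, hC0, hC⟩ := exists_norm_iteratedFDeriv_le_of_hasCompactSupport hgc (hg 0) n
    obtain ⟨C', hC'⟩ := hTr.bound n ⌈s⌉₊
    refine ⟨max C C', fun ℓ x => ?_⟩
    rcases Nat.eq_zero_or_pos ℓ with rfl | hℓ
    · exact (hC x).trans (le_max_left _ _)
    · have hF := hTr.contDiff (R ℓ) (hR1 ℓ)
      have hgℓ : g ℓ = fun y => (R ℓ ^ s : ℝ) •
          (T (R ℓ) (R ℓ • y) - T (2⁻¹ * R ℓ) (R ℓ • y)) := by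
        simp only [g, D, hℓ.ne', if_false]
      rw [hgℓ, iteratedFDeriv_const_smul_apply'
        (hF.contDiffAt.of_le (by exact_mod_cast le_top)), norm_smul,
        Real.norm_of_nonneg (Real.rpow_nonneg (hR0 ℓ).le s)]
      refine (mul_le_mul_of_nonneg_right ?_ (norm_nonneg _)).trans
        ((hC' (R ℓ) (hR1 ℓ) x).trans (le_max_right _ _))
      rw [← Real.rpow_natCast]
      exact Real.rpow_le_rpow_of_exponent_le (hR1 ℓ) (Nat.le_ceil s)
  refine ⟨g, hg, hgs, hgb, fun ℓ β hβ => ?_, fun x => ?_⟩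
  · have h := integral_euclideanMonomial_smul_comp_smul β (D ℓ) (inv_pos.2 (hR0 ℓ))
    rw [hDm ℓ hβ, inv_inv, smul_zero] at h
    simp only [g, smul_comm _ (R ℓ ^ s : ℝ)]
    rw [integral_smul, h, smul_zero]
  · have hterm (ℓ : ℕ) : (R ℓ ^ (-s) : ℝ) • g ℓ ((R ℓ)⁻¹ • x) = D ℓ x := by
      simp only [g]
      rw [smul_inv_smul₀ (hR0 ℓ).ne', smul_smul, ← Real.rpow_add (hR0 ℓ), neg_add_cancel,
        Real.rpow_zero, one_smul]
    have hsumm : Summable fun ℓ : ℕ => ‖(R ℓ ^ (-s) : ℝ) • g ℓ ((R ℓ)⁻¹ • x)‖ := by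
      obtain ⟨C, hC⟩ := hgb 0
      have hgeom : Summable fun ℓ : ℕ => Cb ^ (-s) * C * ((2 : ℝ) ^ (-s)) ^ ℓ :=
        (summable_geometric_of_lt_one (Real.rpow_nonneg zero_le_two _)
          (Real.rpow_lt_one_of_one_lt_of_neg one_lt_two (neg_lt_zero.2 hs))).mul_left _
      refine Summable.of_nonneg_of_le (fun _ => norm_nonneg _) (fun ℓ => ?_) hgeom
      have hrw : R ℓ ^ (-s) = Cb ^ (-s) * ((2 : ℝ) ^ (-s)) ^ ℓ := by
        simp only [R]
        rw [Real.mul_rpow (by linarith) (by positivity), ← Real.rpow_natCast_mul (by norm_num),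
          mul_comm, ← Real.rpow_mul_natCast (by norm_num), mul_comm, mul_comm (-s)]
      have hb := hC ℓ ((R ℓ)⁻¹ • x)
      rw [norm_iteratedFDeriv_zero] at hb
      rw [norm_smul, Real.norm_of_nonneg (Real.rpow_nonneg (hR0 ℓ).le _), hrw,
        mul_right_comm _ C]
      have : (0 : ℝ) ≤ Cb ^ (-s) := Real.rpow_nonneg (by linarith) _
      gcongr
    refine ⟨hsumm, tendsto_nhds_unique
      ((Summable.of_norm hsumm).hasSum.tendsto_sum_nat.comp (Filter.tendsto_add_atTop_nat 1)) ?_⟩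
    have hRlim : Filter.Tendsto R Filter.atTop Filter.atTop :=
      (tendsto_pow_atTop_atTop_of_one_lt (one_lt_two (α := ℝ))).const_mul_atTop (by linarith)
    refine ((hTlim x).comp hRlim).congr fun L => ?_
    simp only [Function.comp_apply]
    rw [← Finset.sum_congr rfl fun ℓ _ => (hterm ℓ).symm]
    exact (hDsum L x).symm

/-- **decomposition into compactly supported pieces with moments.**
Fix `d ≥ 1`, `γ > 0`, `C̄ > 1` and `M ≥ 0`. If `φ` is a Schwartz function on `ℝ^d`
with vanishing moments up to order `M`, then the dilates `φ_j(x) = 2^{−jd}φ(2^{−j}x)`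
decompose as `φ_j = ∑_ℓ (C̄2^ℓ)^{−γ} φ_{ℓ,j}` with `φ_{ℓ,j}` smooth, supported in
`B(0, 2R_{ℓ,j})` where `R_{ℓ,j} = C̄·2^ℓ·2^j`, satisfying uniform derivative bounds
`|∂^μ φ_{ℓ,j}| ≤ C_μ R_{ℓ,j}^{−|μ|}/|B(0,R_{ℓ,j})|` and vanishing moments up to
order `M`. -/
theorem bump_decomposition (d : ℕ) (hd : 1 ≤ d) (γ : ℝ) (hγ : 0 < γ)
    (Cb : ℝ) (hCb : 1 < Cb) (M : ℕ) (φ : SchwartzMap (Em d) ℂ)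
    (hmom : ∀ β : Fin d → ℕ, (∑ i, β i) ≤ M →
      (∫ x : Em d, (∏ i, x i ^ β i) • φ x) = 0) :
    ∃ Φ : ℕ → ℤ → Em d → ℂ,
      (∀ ℓ : ℕ, ∀ j : ℤ, ContDiff ℝ (⊤ : ℕ∞) (Φ ℓ j)) ∧
      (∀ j : ℤ, ∀ x : Em d,
        Summable (fun ℓ : ℕ => ‖((Cb * 2 ^ ℓ) ^ (-γ) : ℝ) • Φ ℓ j x‖) ∧
        (∑' ℓ : ℕ, ((Cb * 2 ^ ℓ) ^ (-γ) : ℝ) • Φ ℓ j x) =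
          ((2 : ℝ) ^ (-(j * (d : ℤ))) : ℝ) • φ ((2 : ℝ) ^ (-j) • x)) ∧
      (∀ ℓ : ℕ, ∀ j : ℤ,
        Function.support (Φ ℓ j) ⊆ ball (0 : Em d) (2 * (Cb * 2 ^ ℓ * (2 : ℝ) ^ j))) ∧
      (∀ μ : List (Fin d), ∃ Cμ : ℝ, 0 < Cμ ∧ ∀ ℓ : ℕ, ∀ j : ℤ, ∀ x : Em d,
        ‖pderivL (μ.map fun i => EuclideanSpace.single i (1 : ℝ)) (Φ ℓ j) x‖ ≤
          Cμ * (Cb * 2 ^ ℓ * (2 : ℝ) ^ j) ^ (-(μ.length : ℝ)) /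
            (volume (ball (0 : Em d) (Cb * 2 ^ ℓ * (2 : ℝ) ^ j))).toReal) ∧
      (∀ ℓ : ℕ, ∀ j : ℤ, ∀ β : Fin d → ℕ, (∑ i, β i) ≤ M →
        (∫ x : Em d, (∏ i, x i ^ β i) • Φ ℓ j x) = 0) := by
  obtain ⟨g, hg, hgs, hgb, hgm, hgsum⟩ := exists_unit_scale_decomposition
    (s := γ + d) (by positivity) hCb M φ hmom
  have hR0 (ℓ : ℕ) : (0 : ℝ) < Cb * 2 ^ ℓ := by positivity
  have hr0 (ℓ : ℕ) (j : ℤ) : (0 : ℝ) < Cb * 2 ^ ℓ * 2 ^ j := by positivity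
  have hsmooth (ℓ : ℕ) (j : ℤ) : ContDiff ℝ ∞ fun x : Em d =>
      ((Cb * 2 ^ ℓ * (2 : ℝ) ^ j) ^ d)⁻¹ • g ℓ ((Cb * 2 ^ ℓ * (2 : ℝ) ^ j)⁻¹ • x) :=
    (hg ℓ).smul_comp_smul _ _
  refine ⟨fun ℓ j x => ((Cb * 2 ^ ℓ * (2 : ℝ) ^ j) ^ d)⁻¹ •
    g ℓ ((Cb * 2 ^ ℓ * (2 : ℝ) ^ j)⁻¹ • x), hsmooth, fun j x => ?_, fun ℓ j x hx => ?_,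
    fun μ => ?_, fun ℓ j β hβ => ?_⟩
  · have hterm (ℓ : ℕ) : ((Cb * 2 ^ ℓ) ^ (-γ) : ℝ) • ((Cb * 2 ^ ℓ * (2 : ℝ) ^ j) ^ d)⁻¹ •
        g ℓ ((Cb * 2 ^ ℓ * (2 : ℝ) ^ j)⁻¹ • x) = ((2 : ℝ) ^ (-(j * (d : ℤ))) : ℝ) •
          ((Cb * 2 ^ ℓ) ^ (-(γ + d)) : ℝ) • g ℓ ((Cb * 2 ^ ℓ)⁻¹ • (2 : ℝ) ^ (-j) • x) := by
      rw [smul_smul, smul_smul, smul_smul, mul_inv, zpow_neg, zpow_neg]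
      congr 1
      rw [neg_add, Real.rpow_add (hR0 ℓ), Real.rpow_neg (hR0 ℓ).le d, Real.rpow_natCast, mul_pow,
        mul_inv, zpow_mul, zpow_natCast]
      ring
    obtain ⟨h1, h2⟩ := hgsum ((2 : ℝ) ^ (-j) • x)
    simp only [hterm]
    refine ⟨?_, ?_⟩
    · simp only [norm_smul _ (_ • g _ _)]
      exact h1.mul_left _
    · rw [tsum_const_smul'', h2]
  · rw [mem_ball_zero_iff]
    by_contra! hle
    refine hx ?_
    have h2 : 2 ≤ ‖(Cb * 2 ^ ℓ * (2 : ℝ) ^ j)⁻¹ • x‖ := by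
      rw [norm_smul, norm_inv, Real.norm_of_nonneg (hr0 ℓ j).le, le_inv_mul_iff₀ (hr0 ℓ j),
        mul_comm]
      exact hle
    simp only [hgs ℓ _ h2, smul_zero]
  · obtain ⟨C, hC⟩ := hgb μ.length
    have : Nonempty (Fin d) := ⟨⟨0, hd⟩⟩
    have hv : 0 < (volume (ball (0 : Em d) 1)).toReal :=
      ENNReal.toReal_pos (measure_ball_pos volume _ one_pos).ne' measure_ball_lt_top.ne
    refine ⟨max C 1 * (volume (ball (0 : Em d) 1)).toReal, by positivity, fun ℓ j x => ?_⟩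
    refine (norm_pderivL_single_le (hsmooth ℓ j) μ x).trans ?_
    have hr := hr0 ℓ j
    rw [norm_iteratedFDeriv_smul_comp_smul (hg ℓ) (by positivity) (by positivity),
      Measure.addHaar_ball volume _ hr.le, Real.rpow_neg hr.le, Real.rpow_natCast,
      ENNReal.toReal_mul, ENNReal.toReal_ofReal (by positivity), finrank_euclideanSpace,
      Fintype.card_fin]
    generalize Cb * 2 ^ ℓ * (2 : ℝ) ^ j = r at hr ⊢
    calc _ ≤ (r ^ d)⁻¹ * r⁻¹ ^ μ.length * max C 1 := by
          gcongr
          exact (hC ℓ _).trans (le_max_left _ _)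
      _ = _ := by
          rw [inv_pow]
          field_simp
  · have h := integral_euclideanMonomial_smul_comp_smul β (g ℓ) (hr0 ℓ j)
    rw [hgm ℓ β hβ, smul_zero] at h
    change ∫ x : Em d, euclideanMonomial β x • _ • _ = 0
    simp only [smul_comm (euclideanMonomial β _)]
    rw [integral_smul, h, smul_zero]
end
end

section
/- For every integer d ≥ 1 and every integer M ≥ 0 there exists a family of smooth functions Θ_ν : ℝ^d → ℝ, indexed by the multi-indices ν with |ν| ≤ M, each supported in the closed unit ball B(0,1) of ℝ^d, which is biorthogonal to the monomials of degree at most M: ∫_{ℝ^d} z^β Θ_ν(z) dz = δ_{β,ν} for all multi-indices β, ν with |β| ≤ M and |ν| ≤ M (where δ_{β,ν} = 1 if β = ν and 0 otherwise). -/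
open MeasureTheory Set Metric ENNReal

noncomputable section

/-- If finitely many continuous functions are linearly independent on the support of a nonnegative
compactly supported weight `w`, then their Gram matrix with respect to `w` is invertible, so
suitable linear combinations of them, multiplied by `w`, form a dual family. -/
theorem exists_biorthogonal_coeff {ι X : Type*} [Fintype ι] [DecidableEq ι]
    [TopologicalSpace X] [MeasurableSpace X] [OpensMeasurableSpace X] (μ : Measure X)
    [IsFiniteMeasureOnCompacts μ] [μ.IsOpenPosMeasure] {w : X → ℝ} (hw : Continuous w)
    (hwc : HasCompactSupport w) (hw0 : 0 ≤ w) {m : ι → X → ℝ} (hm : ∀ i, Continuous (m i))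
    (hli : ∀ c : ι → ℝ, (∀ x, w x ≠ 0 → ∑ i, c i * m i x = 0) → c = 0) :
    ∃ A : Matrix ι ι ℝ, ∀ i k,
      ∫ x, m i x * (w x * ∑ j, A j k * m j x) ∂μ = if i = k then 1 else 0 := by
  let G : Matrix ι ι ℝ := fun i j => ∫ x, m i x * (w x * m j x) ∂μ
  have hint : ∀ i j, Integrable (fun x => m i x * (w x * m j x)) μ := fun i j =>
    ((hm i).mul (hw.mul (hm j))).integrable_of_hasCompactSupport
      ((hwc.mul_right).mul_left)
  have hG : ∀ (c : ι → ℝ) i,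
      ∫ x, m i x * (w x * ∑ j, c j * m j x) ∂μ = ∑ j, G i j * c j := by
    intro c i
    calc ∫ x, m i x * (w x * ∑ j, c j * m j x) ∂μ
        = ∫ x, ∑ j, m i x * (w x * m j x) * c j ∂μ := by
          congr 1 with x
          simp only [Finset.mul_sum]
          exact Finset.sum_congr rfl fun j _ => by ring
      _ = ∑ j, G i j * c j := by
          rw [integral_finsetSum _ fun j _ => (hint i j).mul_const _]
          simp only [integral_mul_const, G]
  have hinj : Function.Injective G.mulVec := by
    rw [← Matrix.coe_mulVecLin, injective_iff_map_eq_zero]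
    intro c hc
    have hc' : ∀ i, ∑ j, G i j * c j = 0 := fun i => congrFun hc i
    let p : X → ℝ := fun x => ∑ i, c i * m i x
    have hp : Continuous p := continuous_finsetSum _ fun i _ => continuous_const.mul (hm i)
    have hzero : ∫ x, p x * (w x * p x) ∂μ = 0 := by
      calc ∫ x, p x * (w x * p x) ∂μ
          = ∫ x, ∑ i, c i * (m i x * (w x * p x)) ∂μ := by
            congr 1 with x
            conv_lhs => rw [show p x = ∑ i, c i * m i x from rfl, Finset.sum_mul]
            exact Finset.sum_congr rfl fun i _ => mul_assoc _ _ _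
        _ = ∑ i, c i * ∫ x, m i x * (w x * p x) ∂μ := by
            rw [integral_finsetSum]
            · simp only [integral_const_mul]
            · exact fun i _ => (((hm i).mul (hw.mul hp)).integrable_of_hasCompactSupport
                ((hwc.mul_right).mul_left)).const_mul _
        _ = 0 := by simp only [p, hG, hc', mul_zero, Finset.sum_const_zero]
    refine hli c fun x hx => ?_
    by_contra hpx
    refine ((hp.mul (hw.mul hp)).integral_pos_of_hasCompactSupport_nonneg_nonzero (μ := μ) (x := x)
      ((hwc.mul_right).mul_left) (fun y => ?_) (mul_ne_zero hpx (mul_ne_zero hx hpx))).ne' hzero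
    calc (0 : ℝ) ≤ w y * (p y * p y) := mul_nonneg (hw0 y) (mul_self_nonneg _)
      _ = p y * (w y * p y) := by ring
  have hdet := (Matrix.isUnit_iff_isUnit_det G).1 (Matrix.mulVec_injective_iff_isUnit.1 hinj)
  refine ⟨G⁻¹, fun i k => ?_⟩
  rw [hG (fun j => G⁻¹ j k), ← Matrix.mul_apply, Matrix.mul_nonsing_inv G hdet, Matrix.one_apply]

/-- Distinct monomials are linearly independent as functions on any neighbourhood of the origin. -/
theorem eq_zero_of_sum_monomials_eq_zero {σ ι : Type*} [Fintype σ] [Fintype ι]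
    {e : ι → σ → ℕ} (he : Function.Injective e) {U : Set (σ → ℝ)} (hU : U ∈ nhds 0) {c : ι → ℝ}
    (h : ∀ x ∈ U, ∑ i, c i * ∏ s, x s ^ e i s = 0) : c = 0 := by
  classical
  obtain ⟨ε, hε, hball⟩ := Metric.mem_nhds_iff.1 hU
  let P : MvPolynomial σ ℝ :=
    ∑ i, MvPolynomial.monomial (Finsupp.equivFunOnFinite.symm (e i)) (c i)
  have hP : P = 0 := by
    refine MvPolynomial.funext_set (fun _ => ball (0 : ℝ) ε)
      (fun _ => infinite_of_mem_nhds 0 (ball_mem_nhds 0 hε)) fun x hx => ?_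
    have hxU : x ∈ U := hball (by rw [ball_pi _ hε]; exact hx)
    simpa [P, MvPolynomial.eval_monomial, Finsupp.prod_fintype] using h x hxU
  funext k
  have hk := congrArg (MvPolynomial.coeff (Finsupp.equivFunOnFinite.symm (e k))) hP
  simpa [P, MvPolynomial.coeff_sum, MvPolynomial.coeff_monomial, he.eq_iff] using hk

/-- **biorthogonal system.** For every `d ≥ 1` and `M ≥ 0` there is a
family of smooth functions `Θ_ν : ℝ^d → ℝ`, indexed by multi-indices `ν` of degree at
most `M`, each supported in the closed unit ball, with
`∫ z^β Θ_ν(z) dz = δ_{β,ν}` for all multi-indices `β, ν` of degree at most `M`. -/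
theorem biorthogonal_system (d : ℕ) (hd : 1 ≤ d) (M : ℕ) :
    ∃ Θ : (Fin d → ℕ) → Em d → ℝ,
      ∀ ν : Fin d → ℕ, (∑ i, ν i) ≤ M →
        ContDiff ℝ (⊤ : ℕ∞) (Θ ν) ∧
        tsupport (Θ ν) ⊆ closedBall (0 : Em d) 1 ∧
        ∀ β : Fin d → ℕ, (∑ i, β i) ≤ M →
          (∫ z : Em d, (∏ i, z i ^ β i) * Θ ν z) = if β = ν then 1 else 0 := by
  let I := {ν : Fin d → ℕ // ∑ i, ν i ≤ M}
  have : Finite I := ((Set.finite_Iic fun _ : Fin d => M).subset fun ν (hν : ∑ i, ν i ≤ M) i =>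
    (Finset.single_le_sum (fun j _ => Nat.zero_le (ν j)) (Finset.mem_univ i)).trans hν).to_subtype
  have : Fintype I := Fintype.ofFinite I
  let w : ContDiffBump (0 : Em d) := ⟨1 / 2, 1, by norm_num, by norm_num⟩
  let m : I → Em d → ℝ := fun γ z => ∏ i, z i ^ γ.1 i
  have hm : ∀ γ, ContDiff ℝ (⊤ : ℕ∞) (m γ) := fun γ => by fun_prop
  obtain ⟨A, hA⟩ := exists_biorthogonal_coeff (volume : Measure (Em d)) w.continuous
    w.hasCompactSupport (fun _ => w.nonneg) (fun γ => (hm γ).continuous) fun c hc => by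
      refine eq_zero_of_sum_monomials_eq_zero (e := fun γ : I => γ.1) Subtype.val_injective
        (U := WithLp.toLp 2 ⁻¹' ball (0 : Em d) 1)
        ((PiLp.continuous_toLp 2 fun _ : Fin d => ℝ).continuousAt.preimage_mem_nhds
          (ball_mem_nhds _ one_pos)) fun x hx => hc _ (w.pos_of_mem_ball hx).ne'
  have key : ∀ ν : Fin d → ℕ, (∑ i, ν i) ≤ M → ∃ θ : Em d → ℝ,
      ContDiff ℝ (⊤ : ℕ∞) θ ∧ tsupport θ ⊆ closedBall (0 : Em d) 1 ∧
        ∀ β : Fin d → ℕ, (∑ i, β i) ≤ M →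
          (∫ z : Em d, (∏ i, z i ^ β i) * θ z) = if β = ν then 1 else 0 := by
    refine fun ν hν => ⟨fun z => w z * ∑ γ, A γ ⟨ν, hν⟩ * m γ z, ?_, ?_, fun β hβ => ?_⟩
    · exact w.contDiff.mul (ContDiff.sum fun γ _ => contDiff_const.mul (hm γ))
    · exact tsupport_mul_subset_left.trans w.tsupport_eq.subset
    · exact (hA ⟨β, hβ⟩ ⟨ν, hν⟩).trans (if_congr Subtype.mk_eq_mk rfl rfl)
  choose! Θ hΘ using key
  exact ⟨Θ, hΘ⟩
end
end
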